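/- Let A be an n×n matrix over ℚ, let f ∈ ℚ[λ] be irreducible of degree d, and suppose χ_A = f^m · h with f not dividing h and f² not dividing the minimal polynomial of A. Then there exist vectors u₁, …, u_m ∈ ker f(A) such that ker f(A) is the internal direct sum of the Krylov subspaces L_A(u₁), …, L_A(u_m), each of dimension d, where L_A(u) = span{u, A·u, …, A^{d−1}·u}. -/

import Mathlib

open Polynomial Matrix

lemma aux_dvd {V : Type} [AddCommGroup V] [Module ℚ V] [Module.Finite ℚ V]
    (ψ : Module.End ℚ V) (q p : ℚ[X]) (hq : Irreducible q) (hdvd : q ∣ LinearMap.charpoly ψ)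
    (hp : aeval ψ p = 0) : q ∣ p := by
  have : Fact (Irreducible q) := ⟨hq⟩
  let b := Module.finBasis ℚ V
  let M := LinearMap.toMatrixAlgEquiv b ψ
  have hM : M.charpoly = LinearMap.charpoly ψ := LinearMap.charpoly_toMatrix ψ b
  have hMp : aeval M p = 0 := by
    have h1 : aeval M p = LinearMap.toMatrixAlgEquiv b (aeval ψ p) :=
      Polynomial.aeval_algHom_apply (LinearMap.toMatrixAlgEquiv b).toAlgHom ψ p
    rw [h1, hp, map_zero]
  let i := algebraMap ℚ (AdjoinRoot q)
  let N := M.map i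
  have hroot : AdjoinRoot.root q ∈ spectrum (AdjoinRoot q) N := by
    rw [Matrix.mem_spectrum_iff_isRoot_charpoly, Matrix.charpoly_map, hM]
    obtain ⟨c, hc⟩ := hdvd
    rw [hc, Polynomial.IsRoot, Polynomial.eval_map]
    have := AdjoinRoot.aeval_eq (f := q) (q * c)
    rw [Polynomial.aeval_def] at this
    refine this.trans ?_
    rw [AdjoinRoot.mk_eq_zero]
    exact dvd_mul_right _ _
  have hN : aeval N (p.map i) = 0 := by
    rw [Polynomial.aeval_map_algebraMap]
    have h1 : aeval N p = (Algebra.ofId ℚ (AdjoinRoot q)).mapMatrix (aeval M p) :=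
      Polynomial.aeval_algHom_apply ((Algebra.ofId ℚ (AdjoinRoot q)).mapMatrix) M p
    rw [h1, hMp, map_zero]
  have h2 := spectrum.subset_polynomial_aeval N (p.map i) ⟨_, hroot, rfl⟩
  rw [hN] at h2
  have hne : Nontrivial (Matrix (Fin (Module.finrank ℚ V)) (Fin (Module.finrank ℚ V)) (AdjoinRoot q)) := by
    by_contra hcon
    rw [not_nontrivial_iff_subsingleton] at hcon
    rw [spectrum.of_subsingleton] at hroot
    exact hroot
  rw [spectrum.zero_eq, Set.mem_singleton_iff] at h2
  simp only [Polynomial.eval_map] at h2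
  rw [← AdjoinRoot.mk_eq_zero, ← AdjoinRoot.aeval_eq, Polynomial.aeval_def]
  exact h2

lemma aux_ker_inv {V : Type} [AddCommGroup V] [Module ℚ V] (φ : Module.End ℚ V) (p : ℚ[X]) :
    ∀ x ∈ LinearMap.ker (aeval φ p), φ x ∈ LinearMap.ker (aeval φ p) := by
  intro x hx
  rw [LinearMap.mem_ker] at hx ⊢
  have h1 : aeval φ p * aeval φ (X : ℚ[X]) = aeval φ (X : ℚ[X]) * aeval φ p := by
    rw [← map_mul, ← map_mul, mul_comm]
  rw [aeval_X] at h1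
  have h2 := LinearMap.congr_fun h1 x
  simp only [Module.End.mul_apply] at h2
  rw [h2, hx, map_zero]

lemma aux_restrict {V : Type} [AddCommGroup V] [Module ℚ V] (φ : Module.End ℚ V)
    (K : Submodule ℚ V) (hK : ∀ x ∈ K, φ x ∈ K) (p : ℚ[X]) (x : K) :
    ((aeval (LinearMap.restrict φ hK : Module.End ℚ K) p x : K) : V) = aeval φ p (x : V) := by
  induction p using Polynomial.induction_on' with
  | add p q hp hq => simp [hp, hq]
  | monomial k a =>
    simp only [aeval_monomial, Module.End.mul_apply, Module.algebraMap_end_apply]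
    rw [Module.End.pow_restrict]
    rfl

lemma aux_restrict_ker {V : Type} [AddCommGroup V] [Module ℚ V] (φ : Module.End ℚ V) (p : ℚ[X]) :
    aeval (LinearMap.restrict φ (aux_ker_inv φ p) :
      Module.End ℚ (LinearMap.ker (aeval φ p))) p = 0 := by
  ext x
  rw [aux_restrict]
  exact x.2

lemma aux_finrank {V : Type} [AddCommGroup V] [Module ℚ V] [Module.Finite ℚ V]
    (φ : Module.End ℚ V) (f h : ℚ[X]) (hf : Irreducible f) (m : ℕ)
    (hchar : LinearMap.charpoly φ = f ^ m * h) (hnd : ¬ f ∣ h)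
    (hmp : ¬ f ^ 2 ∣ minpoly ℚ φ) :
    Module.finrank ℚ (LinearMap.ker (aeval φ f)) = f.natDegree * m := by
  obtain ⟨g, hg, hfg⟩ : ∃ g, ¬ f ∣ g ∧ aeval φ (f * g) = 0 := by
    by_cases h1 : f ∣ minpoly ℚ φ
    · obtain ⟨g, hg⟩ := h1
      refine ⟨g, ?_, by rw [← hg]; exact minpoly.aeval _ _⟩
      rintro ⟨c, rfl⟩
      exact hmp ⟨c, by rw [hg]; ring⟩
    · exact ⟨_, h1, by rw [map_mul, minpoly.aeval, mul_zero]⟩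
  have hcop : IsCoprime f g := hf.coprime_iff_not_dvd.2 hg
  set K := LinearMap.ker (aeval φ f) with hK
  set W := LinearMap.ker (aeval φ g) with hW
  have hinv := aux_ker_inv φ
  have hcompl : IsCompl K W := by
    refine ⟨disjoint_ker_aeval_of_isCoprime φ hcop, codisjoint_iff.2 ?_⟩
    rw [sup_ker_aeval_eq_ker_aeval_mul_of_coprime φ hcop, hfg, LinearMap.ker_zero]
  let φK : Module.End ℚ K := LinearMap.restrict φ (hinv f)
  let φW : Module.End ℚ W := LinearMap.restrict φ (hinv g)
  have hres := aux_restrict_ker φ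
  have hprod : LinearMap.charpoly φ = LinearMap.charpoly φK * LinearMap.charpoly φW := by
    rw [← LinearMap.charpoly_prodMap,
      ← LinearEquiv.charpoly_conj (Submodule.prodEquivOfIsCompl K W hcompl)]
    congr 1
    ext x
    obtain ⟨y, rfl⟩ := (Submodule.prodEquivOfIsCompl K W hcompl).surjective x
    simp [LinearEquiv.conj_apply, φK, φW]
  have hKne : LinearMap.charpoly φK ≠ 0 := (LinearMap.charpoly_monic φK).ne_zero
  obtain ⟨j, c, hc, hjc⟩ := WfDvdMonoid.max_power_factor hKne hf
  have hcu : IsUnit c := by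
    by_contra hcu
    obtain ⟨q, hq, hqc⟩ := WfDvdMonoid.exists_irreducible_factor hcu
      (by rintro rfl; simp at hc)
    have := aux_dvd φK q f hq (hjc ▸ hqc.mul_left _) (hres f)
    exact hc (((hq.associated_of_dvd hf this).symm.dvd).trans hqc)
  have hWf : ¬ f ∣ LinearMap.charpoly φW := fun hd => hg (aux_dvd φW f g hf hd (hres g))
  have hcW : ¬ f ∣ c * LinearMap.charpoly φW := fun hd =>
    (hf.prime.dvd_or_dvd hd).elim hc hWf
  have heq : f ^ m * h = f ^ j * (c * LinearMap.charpoly φW) := by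
    rw [← hchar, hprod, hjc, mul_assoc]
  have hjm : j = m := by
    have key : ∀ (a b : ℕ) (x y : ℚ[X]), ¬ f ∣ x → f ^ a * x = f ^ b * y → ¬ a < b := by
      intro a b x y hx he hab
      obtain ⟨k, rfl⟩ := Nat.exists_eq_add_of_lt hab
      apply hx
      rw [show f ^ (a + k + 1) * y = f ^ a * (f * (f ^ k * y)) by ring] at he
      exact ⟨_, mul_left_cancel₀ (pow_ne_zero _ hf.ne_zero) he⟩
    exact le_antisymm (not_lt.1 (key _ _ _ _ hnd heq)) (not_lt.1 (key _ _ _ _ hcW heq.symm))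
  have hdeg := LinearMap.charpoly_natDegree φK
  rw [← hdeg, hjc, Polynomial.natDegree_mul (pow_ne_zero _ hf.ne_zero) hcu.ne_zero,
    Polynomial.natDegree_pow, Polynomial.natDegree_eq_zero_of_isUnit hcu, hjm, add_zero, mul_comm]

lemma aux_basis {V : Type} [AddCommGroup V] [Module ℚ V] [Module.Finite ℚ V]
    (φ : Module.End ℚ V) (f : ℚ[X]) (hf : Irreducible f) (m : ℕ)
    (hφ : aeval φ f = 0) (hdim : Module.finrank ℚ V = f.natDegree * m) :
    ∃ (u : Fin m → V) (b : Module.Basis (Fin f.natDegree × Fin m) ℚ V),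
      ∀ i k, b (i, k) = (φ ^ (i : ℕ)) (u k) := by
  have : Fact (Irreducible f) := ⟨hf⟩
  let F : AdjoinRoot f →ₐ[ℚ] Module.End ℚ V :=
    Ideal.Quotient.liftₐ (Ideal.span {f}) (aeval φ) (by
      intro a ha
      obtain ⟨c, rfl⟩ := Ideal.mem_span_singleton.1 ha
      rw [map_mul, hφ, zero_mul])
  have hF : F (AdjoinRoot.root f) = φ := by
    have : F (AdjoinRoot.mk f X) = aeval φ X := rfl
    simpa using this
  let : Module (AdjoinRoot f) V := Module.compHom V F.toRingHom
  have hsmul : ∀ (a : AdjoinRoot f) (v : V), a • v = F a v := fun _ _ => rfl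
  have : IsScalarTower ℚ (AdjoinRoot f) V := ⟨fun r a v => by
    rw [hsmul, hsmul, map_smul, LinearMap.smul_apply]⟩
  have : Module.Finite (AdjoinRoot f) V := Module.Finite.of_restrictScalars_finite ℚ _ _
  let pb := AdjoinRoot.powerBasis hf.ne_zero
  have hpd : pb.dim = f.natDegree := AdjoinRoot.powerBasis_dim hf.ne_zero
  have hL : Module.finrank ℚ (AdjoinRoot f) = f.natDegree := by rw [pb.finrank, hpd]
  have hm : Module.finrank (AdjoinRoot f) V = m := by
    have := Module.finrank_mul_finrank ℚ (AdjoinRoot f) V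
    rw [hL, hdim] at this
    exact Nat.eq_of_mul_eq_mul_left hf.natDegree_pos this
  let c := Module.finBasisOfFinrankEq (AdjoinRoot f) V hm
  refine ⟨c, (pb.basis.reindex (finCongr hpd)).smulTower c, fun i k => ?_⟩
  rw [Module.Basis.smulTower_apply]
  simp only [Module.Basis.reindex_apply, PowerBasis.coe_basis]
  rw [hsmul, map_pow, AdjoinRoot.powerBasis_gen, hF]
  rfl

/-- under the hypotheses χ_A = f^m·h, f irreducible of degree d, f ∤ h,
f² ∤ minpoly(A), there exist u₁, …, u_m ∈ ker f(A) with ker f(A) the internal direct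
sum of the Krylov subspaces L_A(u₁), …, L_A(u_m), each of dimension d. -/
theorem stmt_16 {n : ℕ} (A : Matrix (Fin n) (Fin n) ℚ) (f : Polynomial ℚ)
    (hf : Irreducible f) (d : ℕ) (hdeg : f.natDegree = d)
    (m : ℕ) (h : Polynomial ℚ) (hchar : A.charpoly = f ^ m * h)
    (hnd : ¬ f ∣ h) (hmp : ¬ f ^ 2 ∣ minpoly ℚ A) :
    ∃ u : Fin m → (Fin n → ℚ),
      (∀ k, (Polynomial.aeval A f) *ᵥ u k = 0) ∧
      (∀ k, Module.finrank ℚ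
          (Submodule.span ℚ (Set.range fun i : Fin d => (A ^ (i : ℕ)) *ᵥ u k)) = d) ∧
      iSupIndep (fun k : Fin m =>
        Submodule.span ℚ (Set.range fun i : Fin d => (A ^ (i : ℕ)) *ᵥ u k)) ∧
      (⨆ k : Fin m,
          Submodule.span ℚ (Set.range fun i : Fin d => (A ^ (i : ℕ)) *ᵥ u k))
        = LinearMap.ker ((Polynomial.aeval A f).mulVecLin) := by
  subst hdeg
  let φ : Module.End ℚ (Fin n → ℚ) := Matrix.toLinAlgEquiv' A
  have hφp : ∀ p : ℚ[X], aeval φ p = Matrix.toLinAlgEquiv' (aeval A p) := fun p =>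
    Polynomial.aeval_algHom_apply (Matrix.toLinAlgEquiv' (R := ℚ) (n := Fin n)).toAlgHom A p
  have hker : LinearMap.ker ((Polynomial.aeval A f).mulVecLin) = LinearMap.ker (aeval φ f) := by
    rw [hφp]; rfl
  have hdim := aux_finrank φ f h hf m
    (by rw [← hchar]; exact Matrix.charpoly_mulVecLin A) hnd
    (by
      have : minpoly ℚ φ = minpoly ℚ A := minpoly.algEquiv_eq (Matrix.toLinAlgEquiv') A
      rwa [this])
  set K := LinearMap.ker (aeval φ f) with hK
  have hinv : ∀ x ∈ K, φ x ∈ K := aux_ker_inv φ f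
  obtain ⟨u, b, hb⟩ := aux_basis (LinearMap.restrict φ hinv : Module.End ℚ K) f hf m
    (aux_restrict_ker φ f) hdim
  let v : Fin f.natDegree × Fin m → (Fin n → ℚ) := fun p => (b p : Fin n → ℚ)
  have hv : ∀ i k, v (i, k) = (A ^ (i : ℕ)) *ᵥ (u k : Fin n → ℚ) := by
    intro i k
    have h1 : ((b (i, k) : K) : Fin n → ℚ) = (φ ^ (i : ℕ)) (u k) := by
      rw [hb, Module.End.pow_restrict]; rfl
    have h2 : φ ^ (i : ℕ) = Matrix.toLinAlgEquiv' (A ^ (i : ℕ)) := (map_pow _ _ _).symm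
    change ((b (i, k) : K) : Fin n → ℚ) = _
    rw [h1, h2]; rfl
  have hli : LinearIndependent ℚ v :=
    b.linearIndependent.map' K.subtype (Submodule.ker_subtype K)
  have hspan : Submodule.span ℚ (Set.range v) = K := by
    have : Set.range v = K.subtype '' Set.range b := by
      rw [← Set.range_comp]; rfl
    rw [this, Submodule.span_image, b.span_eq, Submodule.map_top, Submodule.range_subtype]
  refine ⟨fun k => u k, ?_, ?_, ?_, ?_⟩
  · intro k
    exact (SetLike.ext_iff.1 hker _).2 (u k).2
  · intro k
    have hk : (fun i : Fin f.natDegree => (A ^ (i : ℕ)) *ᵥ (u k : Fin n → ℚ))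
        = v ∘ (fun i => (i, k)) := funext fun i => (hv i k).symm
    rw [hk, finrank_span_eq_card (hli.comp (fun i => (i, k)) (Prod.mk_left_injective k))]
    simp
  · simp_rw [← hv]
    have himg : ∀ k, (Set.range fun i => v (i, k)) = v '' {p | p.2 = k} := by
      intro k; ext x; simp
    intro k
    simp_rw [himg, ← Submodule.span_iUnion, ← Set.image_iUnion]
    apply hli.disjoint_span_image
    rw [Set.disjoint_left]
    intro p hp hp'
    simp only [Set.mem_iUnion, Set.mem_ofPred_eq] at hp hp'
    obtain ⟨k', hk', he⟩ := hp'
    exact hk' (he.symm.trans hp)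
  · simp_rw [← hv]
    rw [hker, ← hspan, ← Submodule.span_iUnion]
    congr 1
    ext x; simp
    exact exists_comm
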